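/- Let Ω ⊆ ℝ^d be a compact C²-domain and let G ⊆ Ω be a domain of special type attached to ∂Ω. Then the metric ρ̂_G is equivalent to the restriction of ρ_Ω to G: there exists a constant c ≥ 1, depending only on G and Ω, such that c⁻¹ ρ_Ω(ξ,η) ≤ ρ̂_G(ξ,η) ≤ c ρ_Ω(ξ,η) for all ξ, η ∈ G. -/

import Mathlib

open MeasureTheory Set
open scoped ENNReal

noncomputable section

/-- `Ω ⊆ ℝ^d` is a compact `C²`-domain, with `ν` the unit outer normal field on `∂Ω`. -/
def IsCompactC2Domain {d : ℕ} (Ω : Set (EuclideanSpace ℝ (Fin d)))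
    (ν : EuclideanSpace ℝ (Fin d) → EuclideanSpace ℝ (Fin d)) : Prop :=
  IsCompact Ω ∧
  ∃ κ₀ : ℝ, 0 < κ₀ ∧
    ∃ (J : ℕ) (U : Fin J → Set (EuclideanSpace ℝ (Fin d))),
      (∀ j, IsOpen (U j)) ∧
      frontier Ω ⊆ ⋃ j, U j ∧
      (∀ j, ∃ Φ : EuclideanSpace ℝ (Fin d) → ℝ,
        ContDiff ℝ 2 Φ ∧
        U j ∩ frontier Ω = {ξ | ξ ∈ U j ∧ Φ ξ = 0} ∧
        ∀ ξ ∈ U j ∩ frontier Ω,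
          gradient Φ ξ ≠ 0 ∧ ν ξ = ‖gradient Φ ξ‖⁻¹ • gradient Φ ξ) ∧
      ∀ ξ ∈ frontier Ω,
        ‖ν ξ‖ = 1 ∧
        Metric.ball (ξ - κ₀ • ν ξ) κ₀ ⊆ Ω ∧
        Metric.ball (ξ + κ₀ • ν ξ) κ₀ ⊆ Ωᶜ

/-- The metric `ρ_Ω(ξ,η) = ‖ξ-η‖ + |√dist(ξ,∂Ω) − √dist(η,∂Ω)|`. -/
def rhoMetric {d : ℕ} (Ω : Set (EuclideanSpace ℝ (Fin d)))
    (ξ η : EuclideanSpace ℝ (Fin d)) : ℝ :=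
  dist ξ η + |Real.sqrt (Metric.infDist ξ (frontier Ω)) -
    Real.sqrt (Metric.infDist η (frontier Ω))|

/-- The ball `U(ξ,t) = {η ∈ Ω : ρ_Ω(ξ,η) ≤ t}`. -/
def Uball {d : ℕ} (Ω : Set (EuclideanSpace ℝ (Fin d))) (ξ : EuclideanSpace ℝ (Fin d)) (t : ℝ) :
    Set (EuclideanSpace ℝ (Fin d)) := {η ∈ Ω | rhoMetric Ω ξ η ≤ t}

/-- `f` is (the evaluation of) a real polynomial in `d` variables of total degree at most `n`. -/
def IsPolyDeg {d : ℕ} (n : ℕ) (f : EuclideanSpace ℝ (Fin d) → ℝ) : Prop :=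
  ∃ P : MvPolynomial (Fin d) ℝ, P.totalDegree ≤ n ∧
    ∀ x : EuclideanSpace ℝ (Fin d), f x = MvPolynomial.eval (fun i => x i) P

/-- Data describing a domain of special type in `ℝ^d`: an upward (`s = 1`) or downward
(`s = -1`) `x_k`-domain with base point `base`, base size `b`, parameter `L`, and a `C²`
function `g` of the remaining `d-1` coordinates (encoded as a function on `ℝ^d` that does
not depend on the `k`-th coordinate).  Permuting coordinates is realized by the choice of the
vertical coordinate `k`, and the reflection by the sign `s`. -/
structure SpecialDomain (d : ℕ) where
  k : Fin d
  s : ℝ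
  base : EuclideanSpace ℝ (Fin d)
  b : ℝ
  L : ℝ
  g : EuclideanSpace ℝ (Fin d) → ℝ
  s_unit : s = 1 ∨ s = -1
  b_pos : 0 < b
  L_ge : 1 ≤ L
  g_smooth : ContDiff ℝ 2 g
  g_indep : ∀ ξ η : EuclideanSpace ℝ (Fin d), (∀ i, i ≠ k → ξ i = η i) → g ξ = g η

namespace SpecialDomain

variable {d : ℕ} (D : SpecialDomain d)

/-- The set `G(λ)`. -/
def lamSet (lam : ℝ) : Set (EuclideanSpace ℝ (Fin d)) :=
  {ξ | (∀ i, i ≠ D.k → (ξ - D.base) i ∈ Set.Ioo (-(lam * D.b)) (lam * D.b)) ∧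
       D.g (ξ - D.base) - lam * D.L * D.b < D.s * ((ξ - D.base) D.k) ∧
       D.s * ((ξ - D.base) D.k) ≤ D.g (ξ - D.base)}

/-- The underlying set `G = G(1)` of the special domain. -/
def carrier : Set (EuclideanSpace ℝ (Fin d)) := D.lamSet 1

/-- `min_{u ∈ [-2b,2b]^{d-1}} g(u)`. -/
def gMin : ℝ :=
  sInf (D.g '' {u : EuclideanSpace ℝ (Fin d) | ∀ i, u i ∈ Set.Icc (-(2 * D.b)) (2 * D.b)})

/-- The enlarged set `G*`. -/
def star : Set (EuclideanSpace ℝ (Fin d)) :=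
  {ξ | (∀ i, i ≠ D.k → (ξ - D.base) i ∈ Set.Ioo (-(2 * D.b)) (2 * D.b)) ∧
       D.gMin - 4 * D.L * D.b < D.s * ((ξ - D.base) D.k) ∧
       D.s * ((ξ - D.base) D.k) ≤ D.g (ξ - D.base)}

/-- The essential boundary `∂'G(λ)`. -/
def essBnd (lam : ℝ) : Set (EuclideanSpace ℝ (Fin d)) :=
  {ξ | (∀ i, i ≠ D.k → (ξ - D.base) i ∈ Set.Ioo (-(lam * D.b)) (lam * D.b)) ∧
       D.s * ((ξ - D.base) D.k) = D.g (ξ - D.base)}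

/-- The special domain `G ⊆ Ω` is attached to the boundary `∂Ω`:
`closure G* ∩ ∂Ω = closure ∂'G(2)` and `G* = Q ∩ Ω` for an open rectangular box `Q`. -/
def Attached (Ω : Set (EuclideanSpace ℝ (Fin d))) : Prop :=
  D.carrier ⊆ Ω ∧
  closure D.star ∩ frontier Ω = closure (D.essBnd 2) ∧
  ∃ lo hi : Fin d → ℝ,
    D.star = {ξ : EuclideanSpace ℝ (Fin d) | ∀ i, ξ i ∈ Set.Ioo (lo i) (hi i)} ∩ Ω

end SpecialDomain

/-- The metric `ρ̂_G` on a domain of special type: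
`ρ̂_G(ξ,η) = max{ ‖ξ_x − η_x‖, |√(g(ξ_x) − ξ_y) − √(g(η_x) − η_y)| }`
(written in the coordinates of the special domain, with `x` the horizontal part and
`y` the (signed) vertical coordinate). -/
noncomputable def SpecialDomain.rhoHat {d : ℕ} (D : SpecialDomain d)
    (ξ η : EuclideanSpace ℝ (Fin d)) : ℝ :=
  max (Real.sqrt (∑ i ∈ Finset.univ.erase D.k, (ξ i - η i) ^ 2))
      |Real.sqrt (D.g (ξ - D.base) - D.s * ((ξ - D.base) D.k)) -
        Real.sqrt (D.g (η - D.base) - D.s * ((η - D.base) D.k))|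

section RealEstimates

/-- A bound on a difference is divided by the sum of the square roots. -/
theorem sqrt_sub_sqrt_le_of_sub_le {a a' S X : ℝ} (ha : 0 ≤ a) (ha' : 0 ≤ a') (hX : 0 ≤ X)
    (hS : S ≤ √a + √a') (h : a - a' ≤ X * S) : √a - √a' ≤ X := by
  rcases (add_nonneg (Real.sqrt_nonneg a) (Real.sqrt_nonneg a')).eq_or_lt with h0 | h0
  · linarith [Real.sqrt_nonneg a, Real.sqrt_nonneg a']
  · refine le_of_mul_le_mul_right ?_ h0
    calc (√a - √a') * (√a + √a') = √a * √a - √a' * √a' := by ring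
      _ = a - a' := by rw [Real.mul_self_sqrt ha, Real.mul_self_sqrt ha']
      _ ≤ X * S := h
      _ ≤ X * (√a + √a') := by gcongr

theorem abs_sub_eq_abs_sqrt_sub_mul {a a' : ℝ} (ha : 0 ≤ a) (ha' : 0 ≤ a') :
    |a - a'| = |√a - √a'| * (√a + √a') := by
  rw [← abs_of_nonneg (add_nonneg (Real.sqrt_nonneg a) (Real.sqrt_nonneg a')), ← abs_mul]
  congr 1
  calc a - a' = √a * √a - √a' * √a' := by rw [Real.mul_self_sqrt ha, Real.mul_self_sqrt ha']
    _ = (√a - √a') * (√a + √a') := by ring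

end RealEstimates

section C2Estimates

variable {E F : Type*} [NormedAddCommGroup E] [NormedSpace ℝ E]
  [NormedAddCommGroup F] [NormedSpace ℝ F]

/-- A `C¹` function on a finite-dimensional space is Lipschitz on balls. -/
theorem exists_norm_sub_le_on_closedBall [FiniteDimensional ℝ E] {f : E → F}
    (hf : ContDiff ℝ 1 f) (R : ℝ) :
    ∃ K : ℝ, 0 < K ∧ ∀ x ∈ Metric.closedBall (0 : E) R, ∀ y ∈ Metric.closedBall (0 : E) R,
      ‖f x - f y‖ ≤ K * ‖x - y‖ := by
  have : ProperSpace E := FiniteDimensional.proper ℝ E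
  obtain ⟨K, hK⟩ := (isCompact_closedBall (0 : E) R).exists_bound_of_continuousOn
    (hf.continuous_fderiv one_ne_zero).continuousOn
  refine ⟨max K 1, by positivity, fun x hx y hy => ?_⟩
  exact (convex_closedBall (0 : E) R).norm_image_sub_le_of_norm_fderiv_le
    (fun z _ => (hf.differentiable one_ne_zero) z)
    (fun z hz => (hK z hz).trans (le_max_left _ _)) hy hx

/-- Comparison of increments, at different base points and scales, of a function whose
derivative is Lipschitz. -/
theorem abs_scaled_increment_sub_le {f : E → ℝ} (hf : Differentiable ℝ f) {R K : ℝ} (hK : 0 ≤ K)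
    (hlip : ∀ x ∈ Metric.closedBall (0 : E) R, ∀ y ∈ Metric.closedBall (0 : E) R,
      ‖fderiv ℝ f x - fderiv ℝ f y‖ ≤ K * ‖x - y‖)
    {a c v : E} (ha : ‖a‖ + ‖v‖ ≤ R) (hc : ‖c‖ + ‖v‖ ≤ R) {l : ℝ} (hl0 : 0 ≤ l) (hl1 : l ≤ 1) :
    |(f (a + l • v) - f a) - l * (f (c + v) - f c)| ≤
      K * l * ‖v‖ * (‖a - c‖ + (1 - l) * ‖v‖) := by
  let φ : ℝ → ℝ := fun t => f (a + (l * t) • v) - l * f (c + t • v)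
  have hφ : ∀ t, HasDerivAt φ
      (fderiv ℝ f (a + (l * t) • v) (l • v) - l * fderiv ℝ f (c + t • v) v) t := by
    intro t
    have h1 : HasDerivAt (fun t : ℝ => a + (l * t) • v) (l • v) t := by
      simpa using (((hasDerivAt_id t).const_mul l).smul_const v).const_add a
    have h2 : HasDerivAt (fun t : ℝ => c + t • v) v t := by
      simpa using ((hasDerivAt_id t).smul_const v).const_add c
    exact ((hf _).hasFDerivAt.comp_hasDerivAt t h1).sub
      (((hf _).hasFDerivAt.comp_hasDerivAt t h2).const_mul l)
  have hbound : ∀ t ∈ Set.Icc (0 : ℝ) 1,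
      ‖fderiv ℝ f (a + (l * t) • v) (l • v) - l * fderiv ℝ f (c + t • v) v‖ ≤
        K * l * ‖v‖ * (‖a - c‖ + (1 - l) * ‖v‖) := by
    rintro t ⟨ht0, ht1⟩
    have hlt : l * t ≤ 1 := mul_le_one₀ hl1 ht0 ht1
    have hmem : ∀ z : E, ‖z‖ + ‖v‖ ≤ R → ∀ τ : ℝ, 0 ≤ τ → τ ≤ 1 →
        z + τ • v ∈ Metric.closedBall (0 : E) R := by
      intro z hz τ h0 h1
      rw [mem_closedBall_zero_iff]
      refine (norm_add_le _ _).trans (le_trans ?_ hz)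
      rw [norm_smul, Real.norm_of_nonneg h0]
      nlinarith [norm_nonneg v]
    have hD := hlip _ (hmem a ha (l * t) (by positivity) hlt) _ (hmem c hc t ht0 ht1)
    have hdiff : ‖a + (l * t) • v - (c + t • v)‖ ≤ ‖a - c‖ + (1 - l) * ‖v‖ := by
      have : a + (l * t) • v - (c + t • v) = (a - c) - ((1 - l) * t) • v := by module
      rw [this]
      refine (norm_sub_le _ _).trans ?_
      rw [norm_smul, Real.norm_of_nonneg (mul_nonneg (sub_nonneg.2 hl1) ht0)]
      gcongr
      exact mul_le_of_le_one_right (sub_nonneg.2 hl1) ht1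
    have heq : fderiv ℝ f (a + (l * t) • v) (l • v) - l * fderiv ℝ f (c + t • v) v =
        l * ((fderiv ℝ f (a + (l * t) • v) - fderiv ℝ f (c + t • v)) v) := by
      simp only [map_smul, smul_eq_mul, sub_apply]
      ring
    rw [heq, norm_mul, Real.norm_of_nonneg hl0]
    calc l * ‖(fderiv ℝ f (a + (l * t) • v) - fderiv ℝ f (c + t • v)) v‖
        ≤ l * (K * (‖a - c‖ + (1 - l) * ‖v‖) * ‖v‖) := by
          gcongr
          refine (ContinuousLinearMap.le_opNorm _ _).trans ?_
          gcongr
          exact hD.trans (by gcongr)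
      _ = K * l * ‖v‖ * (‖a - c‖ + (1 - l) * ‖v‖) := by ring
  have hmv := (convex_Icc (0 : ℝ) 1).norm_image_sub_le_of_norm_hasDerivWithin_le
    (fun t _ => (hφ t).hasDerivWithinAt) hbound
    (Set.left_mem_Icc.2 zero_le_one) (Set.right_mem_Icc.2 zero_le_one)
  have hval : (f (a + l • v) - f a) - l * (f (c + v) - f c) = φ 1 - φ 0 := by
    simp only [φ, mul_one, mul_zero, zero_smul, add_zero, one_smul]
    ring
  rw [hval]
  simpa using hmv

end C2Estimates

section Comparison

variable {E : Type*} [NormedAddCommGroup E] [NormedSpace ℝ E] [FiniteDimensional ℝ E]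

/-- If the zero set of a `C²` function `h` describes the set `Z` near `G`, then the square roots
of `h` and of the distance to `Z` have comparable increments on `G`, up to the distance of
the points. -/
theorem exists_sqrt_increment_comparison {G Z : Set E} {h : E → ℝ} {r H : ℝ}
    (hG : Bornology.IsBounded G) (hh : ContDiff ℝ 2 h) (hr : 0 < r)
    (hnear : ∀ ξ ∈ G, Metric.infDist ξ Z < r →
      ∃ q, dist ξ q = Metric.infDist ξ Z ∧ h q = 0)
    (hle : ∀ ξ ∈ G, ∀ v : E, ‖v‖ < r → Metric.infDist (ξ + v) Z ≤ |h (ξ + v)|)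
    (h0 : ∀ ξ ∈ G, 0 ≤ h ξ) (hH : ∀ ξ ∈ G, h ξ ≤ H) :
    ∃ C : ℝ, 0 < C ∧ ∀ ξ ∈ G, ∀ η ∈ G,
      |√(Metric.infDist ξ Z) - √(Metric.infDist η Z)| ≤ C * (dist ξ η + |√(h ξ) - √(h η)|) ∧
      |√(h ξ) - √(h η)| ≤
        C * (dist ξ η + |√(Metric.infDist ξ Z) - √(Metric.infDist η Z)|) := by
  set δ : E → ℝ := fun ξ => Metric.infDist ξ Z with hδdef
  have hδ0 : ∀ ξ, 0 ≤ δ ξ := fun ξ => Metric.infDist_nonneg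
  have hδlip : ∀ ξ η, δ ξ ≤ δ η + dist ξ η := fun ξ η => Metric.infDist_le_infDist_add_dist
  obtain ⟨R, hR⟩ := hG.exists_norm_le
  obtain ⟨M₁, hM₁, hlip⟩ := exists_norm_sub_le_on_closedBall (hh.of_le one_le_two) (R + r)
  obtain ⟨K, hK, hDlip⟩ := exists_norm_sub_le_on_closedBall
    (hh.fderiv_right (m := 1) (by norm_num)) (R + r)
  have hball : ∀ ξ ∈ G, ξ ∈ Metric.closedBall (0 : E) (R + r) := fun ξ hξ => by
    rw [mem_closedBall_zero_iff]; linarith [hR ξ hξ]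
  have hδh : ∀ ξ ∈ G, δ ξ ≤ h ξ := fun ξ hξ => by
    simpa [abs_of_nonneg (h0 ξ hξ)] using hle ξ hξ 0 (by simpa using hr)
  obtain ⟨M, hM1, hhδ⟩ : ∃ M : ℝ, 1 ≤ M ∧ ∀ ξ ∈ G, h ξ ≤ M * δ ξ := by
    refine ⟨max 1 (max M₁ (H / r)), le_max_left _ _, fun ξ hξ => ?_⟩
    rcases lt_or_ge (δ ξ) r with hlt | hge
    · obtain ⟨q, hq, hq0⟩ := hnear ξ hξ hlt
      have hqb : q ∈ Metric.closedBall (0 : E) (R + r) := by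
        rw [mem_closedBall_zero_iff]
        have := norm_sub_norm_le q ξ
        rw [← dist_eq_norm, dist_comm, hq] at this
        linarith [hR ξ hξ, show Metric.infDist ξ Z < r from hlt]
      have := hlip ξ (hball ξ hξ) q hqb
      rw [hq0, sub_zero, Real.norm_of_nonneg (h0 ξ hξ), ← dist_eq_norm, hq] at this
      exact this.trans (mul_le_mul_of_nonneg_right
        ((le_max_left _ _).trans (le_max_right _ _)) (hδ0 ξ))
    · have hH0 : 0 ≤ H := (h0 ξ hξ).trans (hH ξ hξ)
      calc h ξ ≤ H := hH ξ hξ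
        _ = H / r * r := by field_simp
        _ ≤ H / r * δ ξ := by gcongr
        _ ≤ _ := mul_le_mul_of_nonneg_right
          ((le_max_right _ _).trans (le_max_right _ _)) (hδ0 ξ)
  have key : ∀ ξ ∈ G, ∀ η ∈ G, δ η < r → ∀ l : ℝ, 0 ≤ l → l ≤ 1 →
      δ ξ ≤ l * δ η + |h ξ - l * h η| + K * l * δ η * (dist ξ η + (1 - l) * δ η) := by
    intro ξ hξ η hη hlt l hl0 hl1
    obtain ⟨q, hq, hq0⟩ := hnear η hη hlt
    have hv : ‖q - η‖ = δ η := by rw [← dist_eq_norm, dist_comm, hq]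
    have hlv : ‖l • (q - η)‖ = l * δ η := by rw [norm_smul, Real.norm_of_nonneg hl0, hv]
    have hs := abs_scaled_increment_sub_le (hh.differentiable two_ne_zero) hK.le hDlip
      (a := ξ) (c := η) (v := q - η) (by linarith [hR ξ hξ]) (by linarith [hR η hη]) hl0 hl1
    rw [add_sub_cancel, hq0, hv, ← dist_eq_norm] at hs
    have h1 := hle ξ hξ (l • (q - η)) (by
      rw [hlv]; exact (mul_le_of_le_one_left (hδ0 η) hl1).trans_lt hlt)
    have h2 := hδlip ξ (ξ + l • (q - η))
    rw [dist_self_add_right, hlv] at h2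
    have h3 : |h (ξ + l • (q - η))| ≤ |h ξ - l * h η| +
        |h (ξ + l • (q - η)) - h ξ - l * (0 - h η)| := by
      refine le_trans (le_of_eq ?_) (abs_add_le _ _)
      congr 1
      ring
    have h1' : δ (ξ + l • (q - η)) ≤ |h (ξ + l • (q - η))| := h1
    linarith
  set ε : ℝ := min r (1 / (2 * K)) with hε
  have hε0 : 0 < ε := by positivity
  have hεK : K * ε ≤ 1 / 2 := by
    calc K * ε ≤ K * (1 / (2 * K)) := by gcongr; exact min_le_right _ _
      _ = 1 / 2 := by field_simp
  have hεr : ε ≤ r := min_le_left _ _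
  have hM0 : 0 < M := by linarith
  have hD : ∀ ξ ∈ G, ∀ η ∈ G, √(δ ξ) - √(δ η) ≤
      (1 / √r + (√M + K * √r)) * (dist ξ η + |√(h ξ) - √(h η)|) := by
    intro ξ hξ η hη
    have hd := dist_nonneg (x := ξ) (y := η)
    have ha := abs_nonneg (√(h ξ) - √(h η))
    rcases lt_or_ge (δ η) r with hlt | hge
    · have hk := key ξ hξ η hη hlt 1 zero_le_one le_rfl
      simp only [one_mul, mul_one, sub_self, zero_mul, add_zero] at hk
      rw [abs_sub_eq_abs_sqrt_sub_mul (h0 ξ hξ) (h0 η hη)] at hk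
      have hsq : ∀ ζ ∈ G, √(h ζ) ≤ √M * √(δ ζ) := fun ζ hζ => by
        rw [← Real.sqrt_mul hM0.le]; exact Real.sqrt_le_sqrt (hhδ ζ hζ)
      have hb : √(δ η) ≤ √r := Real.sqrt_le_sqrt hlt.le
      have hδη : δ η ≤ √r * (√(δ ξ) + √(δ η)) := by
        calc δ η = √(δ η) * √(δ η) := (Real.mul_self_sqrt (hδ0 η)).symm
          _ ≤ √r * (√(δ ξ) + √(δ η)) := by
            gcongr; linarith [Real.sqrt_nonneg (δ ξ)]
      have : √(δ ξ) - √(δ η) ≤ √M * |√(h ξ) - √(h η)| + K * √r * dist ξ η := by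
        refine sqrt_sub_sqrt_le_of_sub_le (hδ0 ξ) (hδ0 η) (by positivity) le_rfl ?_
        calc δ ξ - δ η ≤ |√(h ξ) - √(h η)| * (√(h ξ) + √(h η)) + K * δ η * dist ξ η := by linarith
          _ ≤ |√(h ξ) - √(h η)| * (√M * √(δ ξ) + √M * √(δ η)) +
              K * (√r * (√(δ ξ) + √(δ η))) * dist ξ η := by
            gcongr
            · exact hsq ξ hξ
            · exact hsq η hη
          _ = _ := by ring
      refine this.trans ?_
      calc √M * |√(h ξ) - √(h η)| + K * √r * dist ξ η
          ≤ (1 / √r + (√M + K * √r)) * |√(h ξ) - √(h η)| +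
            (1 / √r + (√M + K * √r)) * dist ξ η := by
            have h1 : 0 ≤ 1 / √r := by positivity
            have h2 : 0 ≤ √M := by positivity
            have h3 : 0 ≤ K * √r := by positivity
            gcongr <;> linarith
        _ = _ := by ring
    · have : √(δ ξ) - √(δ η) ≤ 1 / √r * dist ξ η := by
        refine sqrt_sub_sqrt_le_of_sub_le (S := √r) (hδ0 ξ) (hδ0 η) (by positivity) ?_ ?_
        · linarith [Real.sqrt_le_sqrt hge, Real.sqrt_nonneg (δ ξ)]
        · have : √r ≠ 0 := (Real.sqrt_pos.2 hr).ne'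
          field_simp
          linarith [hδlip ξ η]
      refine this.trans ?_
      gcongr
      · exact le_add_of_nonneg_right (by positivity)
      · linarith
  have hHh : ∀ ξ ∈ G, ∀ η ∈ G, √(h η) - √(h ξ) ≤
      (M₁ / √ε + (2 * M + 2 * M * K * √ε)) * (dist ξ η + |√(δ ξ) - √(δ η)|) := by
    intro ξ hξ η hη
    have hd := dist_nonneg (x := ξ) (y := η)
    have ha := abs_nonneg (√(δ ξ) - √(δ η))
    rcases le_or_gt (h η) (h ξ) with hcase | hcase
    · exact (sub_nonpos.2 (Real.sqrt_le_sqrt hcase)).trans (by positivity)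
    have hηpos : 0 < h η := (h0 ξ hξ).trans_lt hcase
    rcases lt_or_ge (δ η) ε with hlt | hge
    · have hl1 : h ξ / h η ≤ 1 := (div_le_one hηpos).2 hcase.le
      have hl0 : 0 ≤ h ξ / h η := div_nonneg (h0 ξ hξ) hηpos.le
      have hk := key ξ hξ η hη (hlt.trans_le hεr) (h ξ / h η) hl0 hl1
      rw [div_mul_cancel₀ _ hηpos.ne', sub_self, abs_zero, add_zero] at hk
      set l := h ξ / h η with hl
      have hhl : h ξ = l * h η := by rw [hl, div_mul_cancel₀ _ hηpos.ne']
      have hδη := hδ0 η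
      have hX : 0 ≤ dist ξ η + (1 - l) * δ η :=
        add_nonneg hd (mul_nonneg (sub_nonneg.2 hl1) hδη)
      have hk2 : δ ξ ≤ l * δ η + K * δ η * dist ξ η + (1 - l) * δ η / 2 := by
        have e1 : K * l * δ η * (dist ξ η + (1 - l) * δ η) ≤
            K * δ η * (dist ξ η + (1 - l) * δ η) := by
          gcongr
          exact mul_le_of_le_one_right hK.le hl1
        have e2 : K * δ η ≤ 1 / 2 := (mul_le_mul_of_nonneg_left hlt.le hK.le).trans hεK
        have e3 : K * δ η * ((1 - l) * δ η) ≤ 1 / 2 * ((1 - l) * δ η) :=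
          mul_le_mul_of_nonneg_right e2 (mul_nonneg (sub_nonneg.2 hl1) hδη)
        linarith
      have hmain : h η - h ξ ≤ 2 * M * |δ ξ - δ η| + 2 * M * K * δ η * dist ξ η := by
        calc h η - h ξ = (1 - l) * h η := by rw [hhl]; ring
          _ ≤ (1 - l) * (M * δ η) :=
            mul_le_mul_of_nonneg_left (hhδ η hη) (sub_nonneg.2 hl1)
          _ = 2 * M * ((1 - l) * δ η / 2) := by ring
          _ ≤ 2 * M * (|δ ξ - δ η| + K * δ η * dist ξ η) := by
            gcongr
            linarith [neg_abs_le (δ ξ - δ η)]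
          _ = _ := by ring
      have hb : √(δ η) ≤ √ε := Real.sqrt_le_sqrt hlt.le
      have hδb : δ η ≤ √ε * (√(δ ξ) + √(δ η)) := by
        calc δ η = √(δ η) * √(δ η) := (Real.mul_self_sqrt (hδ0 η)).symm
          _ ≤ √ε * (√(δ ξ) + √(δ η)) := by
            gcongr; linarith [Real.sqrt_nonneg (δ ξ)]
      have : √(h η) - √(h ξ) ≤ 2 * M * |√(δ ξ) - √(δ η)| + 2 * M * K * √ε * dist ξ η := by
        refine sqrt_sub_sqrt_le_of_sub_le (S := √(δ ξ) + √(δ η)) (h0 η hη) (h0 ξ hξ)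
          (by positivity) ?_ ?_
        · linarith [Real.sqrt_le_sqrt (hδh ξ hξ), Real.sqrt_le_sqrt (hδh η hη)]
        · rw [abs_sub_eq_abs_sqrt_sub_mul (hδ0 ξ) (hδ0 η)] at hmain
          refine hmain.trans ?_
          calc _ ≤ 2 * M * (|√(δ ξ) - √(δ η)| * (√(δ ξ) + √(δ η))) +
                2 * M * K * (√ε * (√(δ ξ) + √(δ η))) * dist ξ η := by gcongr
            _ = _ := by ring
      refine this.trans ?_
      calc 2 * M * |√(δ ξ) - √(δ η)| + 2 * M * K * √ε * dist ξ η
          ≤ (M₁ / √ε + (2 * M + 2 * M * K * √ε)) * |√(δ ξ) - √(δ η)| +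
            (M₁ / √ε + (2 * M + 2 * M * K * √ε)) * dist ξ η := by
            have h1 : 0 ≤ M₁ / √ε := by positivity
            have h3 : 0 ≤ 2 * M * K * √ε := by positivity
            gcongr <;> linarith
        _ = _ := by ring
    · have : √(h η) - √(h ξ) ≤ M₁ / √ε * dist ξ η := by
        refine sqrt_sub_sqrt_le_of_sub_le (S := √ε) (h0 η hη) (h0 ξ hξ) (by positivity) ?_ ?_
        · linarith [Real.sqrt_le_sqrt (hge.trans (hδh η hη)), Real.sqrt_nonneg (h ξ)]
        · have hne : √ε ≠ 0 := (Real.sqrt_pos.2 hε0).ne'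
          have hl := hlip η (hball η hη) ξ (hball ξ hξ)
          rw [← dist_eq_norm η ξ, dist_comm η ξ] at hl
          calc h η - h ξ ≤ M₁ * dist ξ η := (Real.le_norm_self _).trans hl
            _ = M₁ / √ε * dist ξ η * √ε := by field_simp
      refine this.trans ?_
      gcongr
      · exact le_add_of_nonneg_right (by positivity)
      · linarith
  refine ⟨max (1 / √r + (√M + K * √r)) (M₁ / √ε + (2 * M + 2 * M * K * √ε)),
    lt_max_of_lt_left (by positivity), fun ξ hξ η hη => ⟨?_, ?_⟩⟩
  · refine le_trans ?_ (mul_le_mul_of_nonneg_right (le_max_left _ _) (by positivity))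
    refine abs_sub_le_iff.2 ⟨hD ξ hξ η hη, ?_⟩
    have := hD η hη ξ hξ
    rwa [dist_comm, abs_sub_comm] at this
  · refine le_trans ?_ (mul_le_mul_of_nonneg_right (le_max_right _ _) (by positivity))
    refine abs_sub_le_iff.2 ⟨?_, hHh ξ hξ η hη⟩
    have := hHh η hη ξ hξ
    rwa [dist_comm, abs_sub_comm (√(δ η))] at this

end Comparison

namespace SpecialDomain

variable {d : ℕ} (D : SpecialDomain d)

/-- The height of the graph of `g` above the point `ξ`. -/
def depth (ξ : EuclideanSpace ℝ (Fin d)) : ℝ :=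
  D.g (ξ - D.base) - D.s * ((ξ - D.base) D.k)

theorem contDiff_depth : ContDiff ℝ 2 D.depth := by
  have hg := D.g_smooth
  unfold depth
  have h1 : ContDiff ℝ 2 fun ξ : EuclideanSpace ℝ (Fin d) => ξ - D.base :=
    contDiff_id.sub contDiff_const
  exact (hg.comp h1).sub (contDiff_const.mul ((contDiff_euclidean.1 h1) D.k))

theorem s_mul_s : D.s * D.s = 1 := by
  rcases D.s_unit with h | h <;> simp [h]

theorem abs_s : |D.s| = 1 := by
  rcases D.s_unit with h | h <;> simp [h]

/-- The vertical projection onto the graph of `g`. -/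
def graphProj (ξ : EuclideanSpace ℝ (Fin d)) : EuclideanSpace ℝ (Fin d) :=
  ξ + EuclideanSpace.single D.k (D.s * D.depth ξ)

theorem dist_graphProj (ξ : EuclideanSpace ℝ (Fin d)) :
    dist ξ (D.graphProj ξ) = |D.depth ξ| := by
  rw [graphProj, dist_self_add_right, PiLp.norm_single, Real.norm_eq_abs, abs_mul,
    D.abs_s, one_mul]

theorem graphProj_mem_essBnd {ξ : EuclideanSpace ℝ (Fin d)} {lam : ℝ}
    (h : ∀ i, i ≠ D.k → (ξ - D.base) i ∈ Set.Ioo (-(lam * D.b)) (lam * D.b)) :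
    D.graphProj ξ ∈ D.essBnd lam := by
  have hcoord : ∀ i, i ≠ D.k → (D.graphProj ξ - D.base) i = (ξ - D.base) i := fun i hi => by
    simp [graphProj, hi]
  refine ⟨fun i hi => hcoord i hi ▸ h i hi, ?_⟩
  rw [D.g_indep _ _ hcoord]
  have : (D.graphProj ξ - D.base) D.k = (ξ - D.base) D.k + D.s * D.depth ξ := by
    simp [graphProj]
    ring
  rw [this, mul_add, ← mul_assoc, D.s_mul_s, depth]
  ring

theorem gMin_le {ξ : EuclideanSpace ℝ (Fin d)}
    (h : ∀ i, i ≠ D.k → ξ i ∈ Set.Icc (-(2 * D.b)) (2 * D.b)) : D.gMin ≤ D.g ξ := by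
  have hb := D.b_pos
  have hcompact : IsCompact {u : EuclideanSpace ℝ (Fin d) |
      ∀ i, u i ∈ Set.Icc (-(2 * D.b)) (2 * D.b)} := by
    have := (isCompact_univ_pi fun _ : Fin d => isCompact_Icc (a := -(2 * D.b)) (b := 2 * D.b)).image
      (PiLp.continuous_toLp 2 fun _ : Fin d => ℝ)
    refine this.of_isClosed_subset ?_ ?_
    · simp only [Set.ofPred_forall]
      exact isClosed_iInter fun i => isClosed_Icc.preimage (by fun_prop)
    · exact fun u hu => ⟨fun i => u i, fun i _ => hu i, rfl⟩
  have hbdd := (hcompact.image D.g_smooth.continuous).bddBelow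
  refine csInf_le hbdd ⟨ξ - EuclideanSpace.single D.k (ξ D.k), fun i => ?_,
    D.g_indep _ _ fun i hi => by simp [hi]⟩
  by_cases hi : i = D.k
  · subst hi
    simp [hb.le]
  · simpa [hi] using h i hi

theorem depth_mem_Icc_of_mem_carrier {ξ : EuclideanSpace ℝ (Fin d)} (hξ : ξ ∈ D.carrier) :
    0 ≤ D.depth ξ ∧ D.depth ξ ≤ D.L * D.b := by
  obtain ⟨-, h1, h2⟩ := hξ
  rw [depth]
  constructor <;> linarith

theorem closure_carrier_subset_star : closure D.carrier ⊆ D.star := by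
  have hb := D.b_pos
  have hcont := D.contDiff_depth.continuous
  have hclosed : IsClosed ({ξ : EuclideanSpace ℝ (Fin d) |
      ∀ i, i ≠ D.k → (ξ - D.base) i ∈ Set.Icc (-D.b) D.b} ∩
        D.depth ⁻¹' Set.Icc 0 (D.L * D.b)) := by
    refine IsClosed.inter ?_ (isClosed_Icc.preimage hcont)
    simp only [Set.ofPred_forall]
    exact isClosed_iInter fun i => isClosed_iInter fun _ => isClosed_Icc.preimage (by fun_prop)
  have hsub : D.carrier ⊆ {ξ : EuclideanSpace ℝ (Fin d) |
      ∀ i, i ≠ D.k → (ξ - D.base) i ∈ Set.Icc (-D.b) D.b} ∩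
        D.depth ⁻¹' Set.Icc 0 (D.L * D.b) := fun ξ hξ => by
    refine ⟨fun i hi => Set.Ioo_subset_Icc_self ?_, D.depth_mem_Icc_of_mem_carrier hξ⟩
    simpa using hξ.1 i hi
  intro ξ hξ
  obtain ⟨hx, h1, h2⟩ := closure_minimal hsub hclosed hξ
  have hmin : D.gMin ≤ D.g (ξ - D.base) := D.gMin_le fun i hi =>
    ⟨by linarith [(hx i hi).1], by linarith [(hx i hi).2]⟩
  have hLb : 0 < D.L * D.b := mul_pos (by linarith [D.L_ge]) hb
  rw [depth] at h1 h2
  refine ⟨fun i hi => ⟨by linarith [(hx i hi).1], by linarith [(hx i hi).2]⟩, ?_, ?_⟩ <;>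
    linarith

theorem depth_eq_zero_of_mem_closure_essBnd {q : EuclideanSpace ℝ (Fin d)} {lam : ℝ}
    (hq : q ∈ closure (D.essBnd lam)) : D.depth q = 0 := by
  refine closure_minimal (s := D.essBnd lam) (t := {q | D.depth q = 0}) ?_ ?_ hq
  · intro z hz
    rw [Set.mem_ofPred_eq, depth, hz.2, sub_self]
  · exact isClosed_eq D.contDiff_depth.continuous continuous_const

/-- Moving `η` vertically to the level of `ξ` leaves only the horizontal distance. -/
theorem dist_vertical_shift (ξ η : EuclideanSpace ℝ (Fin d)) :
    dist ξ (η + EuclideanSpace.single D.k (ξ D.k - η D.k)) =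
      √(∑ i ∈ Finset.univ.erase D.k, (ξ i - η i) ^ 2) := by
  rw [EuclideanSpace.dist_eq, ← Finset.add_sum_erase _ _ (Finset.mem_univ D.k)]
  congr 1
  simp only [PiLp.add_apply, PiLp.single_apply, if_true, add_sub_cancel, dist_self]
  rw [zero_pow two_ne_zero, zero_add]
  refine Finset.sum_congr rfl fun i hi => ?_
  rw [if_neg (Finset.ne_of_mem_erase hi), add_zero, Real.dist_eq, sq_abs]

theorem sqrt_sum_erase_le_dist (ξ η : EuclideanSpace ℝ (Fin d)) :
    √(∑ i ∈ Finset.univ.erase D.k, (ξ i - η i) ^ 2) ≤ dist ξ η := by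
  rw [EuclideanSpace.dist_eq]
  refine Real.sqrt_le_sqrt ?_
  simp only [Real.dist_eq, sq_abs]
  exact Finset.sum_le_sum_of_subset_of_nonneg (Finset.erase_subset _ _)
    fun _ _ _ => sq_nonneg _

/-- On bounded sets of points lying below the graph, the Euclidean distance is controlled
by `rhoHat`. -/
theorem exists_dist_le_rhoHat {S : Set (EuclideanSpace ℝ (Fin d))} {H : ℝ}
    (hS : Bornology.IsBounded S) (h0 : ∀ ξ ∈ S, 0 ≤ D.depth ξ) (hH : ∀ ξ ∈ S, D.depth ξ ≤ H) :
    ∃ C : ℝ, 0 < C ∧ ∀ ξ ∈ S, ∀ η ∈ S, dist ξ η ≤ C * D.rhoHat ξ η := by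
  obtain ⟨R, hR⟩ := hS.exists_norm_le
  obtain ⟨M, hM, hlip⟩ := exists_norm_sub_le_on_closedBall (D.contDiff_depth.of_le one_le_two)
    (3 * R)
  refine ⟨1 + M + 2 * √H, by positivity, fun ξ hξ η hη => ?_⟩
  set X : ℝ := √(∑ i ∈ Finset.univ.erase D.k, (ξ i - η i) ^ 2) with hX
  set η' := η + EuclideanSpace.single D.k (ξ D.k - η D.k) with hη'
  have hd' : dist ξ η' = X := D.dist_vertical_shift ξ η
  have hXd : X ≤ dist ξ η := D.sqrt_sum_erase_le_dist ξ η
  have hξη : dist ξ η ≤ R + R := (dist_le_norm_add_norm _ _).trans (add_le_add (hR ξ hξ) (hR η hη))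
  have hR0 : 0 ≤ R := (norm_nonneg _).trans (hR ξ hξ)
  have hl := hlip ξ (mem_closedBall_zero_iff.2 (by linarith [hR ξ hξ])) η' (by
    rw [mem_closedBall_zero_iff]
    have := norm_sub_norm_le η' ξ
    rw [← dist_eq_norm, dist_comm, hd'] at this
    linarith [hR ξ hξ])
  rw [← dist_eq_norm, ← dist_eq_norm, hd', dist_comm, Real.dist_eq] at hl
  have hdepth : D.depth η' = D.depth η - D.s * (ξ D.k - η D.k) := by
    have hg : D.g (η' - D.base) = D.g (η - D.base) := D.g_indep _ _ fun i hi => by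
      simp [hη', hi]
    have hk : (η' - D.base) D.k = (η - D.base) D.k + (ξ D.k - η D.k) := by
      simp [hη']
    rw [depth, depth, hg, hk]
    ring
  have hvert : dist η' η = |D.s * (ξ D.k - η D.k)| := by
    rw [hη', dist_comm, dist_self_add_right, PiLp.norm_single, abs_mul, D.abs_s, one_mul,
      Real.norm_eq_abs]
  have hvert' : dist η' η ≤ |D.depth ξ - D.depth η| + M * X := by
    rw [hvert]
    calc |D.s * (ξ D.k - η D.k)|
        = |(D.depth η - D.depth ξ) - (D.depth η' - D.depth ξ)| := by rw [hdepth]; congr 1; ring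
      _ ≤ |D.depth η - D.depth ξ| + |D.depth η' - D.depth ξ| := abs_sub _ _
      _ ≤ _ := by rw [abs_sub_comm]; gcongr
  rw [abs_sub_eq_abs_sqrt_sub_mul (h0 ξ hξ) (h0 η hη)] at hvert'
  have h1 : X ≤ D.rhoHat ξ η := le_max_left _ _
  have h2 : |√(D.depth ξ) - √(D.depth η)| ≤ D.rhoHat ξ η := le_max_right _ _
  have hρ : 0 ≤ D.rhoHat ξ η := (Real.sqrt_nonneg _).trans h1
  calc dist ξ η ≤ dist ξ η' + dist η' η := dist_triangle _ _ _
    _ ≤ X + (|√(D.depth ξ) - √(D.depth η)| * (√(D.depth ξ) + √(D.depth η)) + M * X) := by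
      rw [hd']; gcongr
    _ ≤ D.rhoHat ξ η + (D.rhoHat ξ η * (√H + √H) + M * D.rhoHat ξ η) := by
      gcongr
      · exact hH ξ hξ
      · exact hH η hη
    _ = _ := by ring

/-- Near an attached special domain, the boundary is the graph of `g`. -/
theorem exists_boundary_eq_graph {Ω : Set (EuclideanSpace ℝ (Fin d))} (hΩ : IsCompact Ω)
    (hatt : D.Attached Ω) :
    ∃ r : ℝ, 0 < r ∧
      (∀ ξ ∈ D.carrier, Metric.infDist ξ (frontier Ω) < r →
        ∃ q, dist ξ q = Metric.infDist ξ (frontier Ω) ∧ D.depth q = 0) ∧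
      ∀ ξ ∈ D.carrier, ∀ v, ‖v‖ < r →
        Metric.infDist (ξ + v) (frontier Ω) ≤ |D.depth (ξ + v)| := by
  obtain ⟨hsub, hfr, lo, hi, hstar⟩ := hatt
  have hb := D.b_pos
  have hess : D.essBnd 2 ⊆ frontier Ω := fun z hz =>
    (hfr ▸ subset_closure hz : z ∈ closure D.star ∩ frontier Ω).2
  have hne : (frontier Ω).Nonempty :=
    ⟨_, hess (D.graphProj_mem_essBnd (ξ := D.base) (lam := 2) fun i _ => by simp [hb])⟩
  have hfc : IsCompact (frontier Ω) :=
    hΩ.of_isClosed_subset isClosed_frontier hΩ.isClosed.frontier_subset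
  set Q := {ξ : EuclideanSpace ℝ (Fin d) | ∀ i, ξ i ∈ Set.Ioo (lo i) (hi i)} with hQ
  have hQo : IsOpen Q := by
    simp only [hQ, Set.ofPred_forall]
    exact isOpen_iInter_of_finite fun i => isOpen_Ioo.preimage (by fun_prop)
  have hGQ : closure D.carrier ⊆ Q := fun z hz =>
    (hstar ▸ D.closure_carrier_subset_star hz : z ∈ Q ∩ Ω).1
  have hGc : IsCompact (closure D.carrier) :=
    hΩ.of_isClosed_subset isClosed_closure (closure_minimal hsub hΩ.isClosed)
  obtain ⟨r, hr, hthick⟩ := hGc.exists_thickening_subset_open hQo hGQ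
  refine ⟨min r D.b, lt_min hr hb, fun ξ hξ hlt => ?_, fun ξ hξ v hv => ?_⟩
  · obtain ⟨q, hq, hqd⟩ := hfc.exists_infDist_eq_dist hne ξ
    refine ⟨q, hqd.symm, D.depth_eq_zero_of_mem_closure_essBnd (lam := 2) ?_⟩
    have hqQ : q ∈ Q := hthick <| Metric.mem_thickening_iff.2 ⟨ξ, subset_closure hξ, by
      rw [dist_comm, ← hqd]; exact hlt.trans_le (min_le_left _ _)⟩
    have hqs : q ∈ D.star := hstar ▸ ⟨hqQ, hΩ.isClosed.frontier_subset hq⟩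
    exact hfr ▸ ⟨subset_closure hqs, hq⟩
  · rw [← D.dist_graphProj]
    refine Metric.infDist_le_dist_of_mem (hess (D.graphProj_mem_essBnd fun i hi => ?_))
    have h1 := hξ.1 i hi
    have h2 : |v i| < D.b :=
      ((PiLp.norm_apply_le v i).trans_lt hv).trans_le (min_le_right _ _)
    rw [abs_lt] at h2
    simp only [PiLp.sub_apply, PiLp.add_apply, Set.mem_Ioo] at h1 ⊢
    constructor <;> linarith [h1.1, h1.2, h2.1, h2.2]

end SpecialDomain

/-- **Proposition 3.1** (equivalence of metrics): if `G ⊆ Ω` is a domain of special type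
attached to `∂Ω`, then `ρ̂_G ∼ ρ_Ω` on `G`. -/
theorem rhoHat_equiv_rho {d : ℕ} (hd : 2 ≤ d)
    (Ω : Set (EuclideanSpace ℝ (Fin d)))
    (ν : EuclideanSpace ℝ (Fin d) → EuclideanSpace ℝ (Fin d))
    (hΩ : IsCompactC2Domain Ω ν)
    (D : SpecialDomain d) (hD : D.carrier ⊆ Ω) (hatt : D.Attached Ω) :
    ∃ c : ℝ, 1 ≤ c ∧ ∀ ξ ∈ D.carrier, ∀ η ∈ D.carrier,
      c⁻¹ * rhoMetric Ω ξ η ≤ D.rhoHat ξ η ∧ D.rhoHat ξ η ≤ c * rhoMetric Ω ξ η := by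
  have hG : Bornology.IsBounded D.carrier := hΩ.1.isBounded.subset hD
  have h0 : ∀ ξ ∈ D.carrier, 0 ≤ D.depth ξ := fun ξ hξ => (D.depth_mem_Icc_of_mem_carrier hξ).1
  have hH : ∀ ξ ∈ D.carrier, D.depth ξ ≤ D.L * D.b := fun ξ hξ =>
    (D.depth_mem_Icc_of_mem_carrier hξ).2
  obtain ⟨r, hr, hnear, hle⟩ := D.exists_boundary_eq_graph hΩ.1 hatt
  obtain ⟨C, hC, hcomp⟩ :=
    exists_sqrt_increment_comparison hG D.contDiff_depth hr hnear hle h0 hH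
  obtain ⟨A, hA, hdist⟩ := D.exists_dist_le_rhoHat hG h0 hH
  refine ⟨(1 + C) * (1 + A), by nlinarith, fun ξ hξ η hη => ?_⟩
  obtain ⟨h1, h2⟩ := hcomp ξ hξ η hη
  have h3 := hdist ξ hξ η hη
  have h4 : |√(D.depth ξ) - √(D.depth η)| ≤ D.rhoHat ξ η := le_max_right _ _
  have hρ : 0 ≤ D.rhoHat ξ η := (abs_nonneg _).trans h4
  have hδ : |√(Metric.infDist ξ (frontier Ω)) - √(Metric.infDist η (frontier Ω))| =
      rhoMetric Ω ξ η - dist ξ η := (add_sub_cancel_left _ _).symm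
  have hd : dist ξ η ≤ rhoMetric Ω ξ η := le_add_of_nonneg_right (abs_nonneg _)
  have hρ' : 0 ≤ rhoMetric Ω ξ η := dist_nonneg.trans hd
  rw [hδ] at h1 h2
  constructor
  · rw [inv_mul_le_iff₀ (by positivity)]
    calc rhoMetric Ω ξ η ≤ (1 + C) * (dist ξ η + |√(D.depth ξ) - √(D.depth η)|) := by
          linarith [abs_nonneg (√(D.depth ξ) - √(D.depth η))]
      _ ≤ (1 + C) * (A * D.rhoHat ξ η + D.rhoHat ξ η) := by gcongr
      _ = _ := by ring
  · have h5 : D.rhoHat ξ η ≤ (1 + C) * rhoMetric Ω ξ η := by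
      refine max_le ((D.sqrt_sum_erase_le_dist ξ η).trans ?_) (h2.trans ?_)
      · nlinarith
      · linarith
    refine h5.trans (mul_le_mul_of_nonneg_right ?_ hρ')
    nlinarith
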